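/- Fix t ∈ ℝ. For every ε > 0 and every x ∈ X_α there exist infinitely many k ∈ ℕ for which there is a sequence 𝐢 ∈ Σ such that: (1) the distance from x to R_k(𝐢) is at most D₁ m^{−k}; (2) A_k(𝐢) ≥ −ε; and (3) R_k(𝐢) ∈ Y(α,ε,k). -/

import Mathlib

open MeasureTheory Metric Real Set Filter
open scoped ENNReal Topology

noncomputable section BedfordMcMullen

/-- `σ = log m / log n`. -/
def sig (m n : ℕ) : ℝ := Real.log m / Real.log n

/-- `l(k) = ⌊σ k⌋`. -/
def lk (m n k : ℕ) : ℕ := ⌊sig m n * k⌋₊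

/-- The affine contraction `T_{i,j}(x,y) = ((x+j)/n, (y+i)/m)` for the digit `d = (i,j)`. -/
def Tmap (m n : ℕ) (d : ℕ × ℕ) (x : ℝ × ℝ) : ℝ × ℝ :=
  ((x.1 + d.2) / n, (x.2 + d.1) / m)

/-- `Λ` is the Bedford–McMullen carpet: the unique nonempty compact set with
`Λ = ⋃_{d ∈ D} T_d(Λ)`. -/
def IsAttractor (m n : ℕ) (D : Finset (ℕ × ℕ)) (Λ : Set (ℝ × ℝ)) : Prop :=
  IsCompact Λ ∧ Λ.Nonempty ∧ Λ = ⋃ d ∈ D, Tmap m n d '' Λ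

/-- `μ` is the self-affine (Bernoulli) measure with weights `p`. -/
def IsSelfAffine (m n : ℕ) (D : Finset (ℕ × ℕ)) (p : ℕ × ℕ → ℝ)
    (μ : Measure (ℝ × ℝ)) : Prop :=
  ∀ A : Set (ℝ × ℝ), MeasurableSet A →
    μ A = ∑ d ∈ D, ENNReal.ofReal (p d) * μ (Tmap m n d ⁻¹' A)

/-- `q_i = Σ_{j : (i,j) ∈ D} p_{ij}`. -/
def qrow (D : Finset (ℕ × ℕ)) (p : ℕ × ℕ → ℝ) (i : ℕ) : ℝ :=
  ∑ d ∈ D.filter fun d => d.1 = i, p d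

/-- `γ_i(t) = Σ_{j : (i,j) ∈ D} p_{ij}^t`. -/
def gam (D : Finset (ℕ × ℕ)) (p : ℕ × ℕ → ℝ) (t : ℝ) (i : ℕ) : ℝ :=
  ∑ d ∈ D.filter fun d => d.1 = i, p d ^ t

/-- `β` satisfies, for every `t`, the defining equation
`m^{β(t)} Σ_{(i,j)∈D} p_{ij}^t q_i^{(1-σ)t} γ_i^{σ-1} = 1`. -/
def IsBeta (m n : ℕ) (D : Finset (ℕ × ℕ)) (p : ℕ × ℕ → ℝ) (β : ℝ → ℝ) : Prop :=
  ∀ t : ℝ, (m : ℝ) ^ β t *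
      ∑ d ∈ D, p d ^ t * qrow D p d.1 ^ ((1 - sig m n) * t) * gam D p t d.1 ^ (sig m n - 1) = 1

/-- The local dimension of `μ` at `x` exists and equals `α`. -/
def HasLocalDim (μ : Measure (ℝ × ℝ)) (x : ℝ × ℝ) (α : ℝ) : Prop :=
  Tendsto (fun r : ℝ => Real.log (μ (ball x r)).toReal / Real.log r) (𝓝[>] 0) (𝓝 α)

/-- `X_α = {x ∈ Λ : d_μ(x) = α}`. -/
def levelSet (μ : Measure (ℝ × ℝ)) (Λ : Set (ℝ × ℝ)) (α : ℝ) : Set (ℝ × ℝ) :=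
  {x | x ∈ Λ ∧ HasLocalDim μ x α}

/-- `α_min = min_{(i,j)∈D} (−σ log p_{ij} + (σ−1) log q_i)/log m`. -/
def alphaMin (m : ℕ) (D : Finset (ℕ × ℕ)) (p : ℕ × ℕ → ℝ) (σ : ℝ) : ℝ :=
  sInf ((fun d => (-σ * Real.log (p d) + (σ - 1) * Real.log (qrow D p d.1)) / Real.log m) ''
    (D : Set (ℕ × ℕ)))

/-- `α_max = max_{(i,j)∈D} (−σ log p_{ij} + (σ−1) log q_i)/log m`. -/
def alphaMax (m : ℕ) (D : Finset (ℕ × ℕ)) (p : ℕ × ℕ → ℝ) (σ : ℝ) : ℝ :=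
  sSup ((fun d => (-σ * Real.log (p d) + (σ - 1) * Real.log (qrow D p d.1)) / Real.log m) ''
    (D : Set (ℕ × ℕ)))

/-- A digit of `D`. -/
abbrev Digit (D : Finset (ℕ × ℕ)) := {d : ℕ × ℕ // d ∈ D}

/-- The symbol space `Σ = D^ℕ` (indexed from `0`; position `r` of the paper is index `r-1`). -/
abbrev Word (D : Finset (ℕ × ℕ)) := ℕ → Digit D

/-- The natural projection `Π : Σ → ℝ²`. -/
def proj (m n : ℕ) {D : Finset (ℕ × ℕ)} (i : Word D) : ℝ × ℝ :=
  (∑' k : ℕ, ((i k).1.2 : ℝ) * (n : ℝ) ^ (-(k + 1 : ℤ)),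
   ∑' k : ℕ, ((i k).1.1 : ℝ) * (m : ℝ) ^ (-(k + 1 : ℤ)))

/-- The approximate square `R_k(𝐢)`. -/
def approxSq (m n : ℕ) {D : Finset (ℕ × ℕ)} (k : ℕ) (i : Word D) : Set (ℝ × ℝ) :=
  Icc (∑ r ∈ Finset.range (lk m n k), ((i r).1.2 : ℝ) * (n : ℝ) ^ (-(r + 1 : ℤ)))
      (∑ r ∈ Finset.range (lk m n k), ((i r).1.2 : ℝ) * (n : ℝ) ^ (-(r + 1 : ℤ)) +
        (n : ℝ) ^ (-(lk m n k : ℤ))) ×ˢ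
  Icc (∑ r ∈ Finset.range k, ((i r).1.1 : ℝ) * (m : ℝ) ^ (-(r + 1 : ℤ)))
      (∑ r ∈ Finset.range k, ((i r).1.1 : ℝ) * (m : ℝ) ^ (-(r + 1 : ℤ)) + (m : ℝ) ^ (-(k : ℤ)))

/-- `D₁ = √(n² + 1)`. -/
def D1 (n : ℕ) : ℝ := Real.sqrt ((n : ℝ) ^ 2 + 1)

/-- The symbolic local dimension of `μ` along `𝐢` exists and equals `α`. -/
def HasSymbDim (m n : ℕ) {D : Finset (ℕ × ℕ)} (μ : Measure (ℝ × ℝ)) (i : Word D)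
    (α : ℝ) : Prop :=
  Tendsto (fun k : ℕ => -Real.log (μ (approxSq m n k i)).toReal / ((k : ℝ) * Real.log m))
    atTop (𝓝 α)

/-- `R_k(𝐢) ∈ Y(α, ε, k)`, i.e. `m^{-kα(1+ε)} ≤ μ(R_k(𝐢)) ≤ m^{-kα(1-ε)}`. -/
def MemY (m n : ℕ) {D : Finset (ℕ × ℕ)} (μ : Measure (ℝ × ℝ)) (α ε : ℝ) (k : ℕ)
    (i : Word D) : Prop :=
  ENNReal.ofReal ((m : ℝ) ^ (-((k : ℝ) * α * (1 + ε)))) ≤ μ (approxSq m n k i) ∧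
    μ (approxSq m n k i) ≤ ENNReal.ofReal ((m : ℝ) ^ (-((k : ℝ) * α * (1 - ε))))

/-- `P_{ij} = p_{ij}^t m^{β(t)} q_i^{(1−σ)t} γ_i^{σ−1}`. -/
def Pweight (m n : ℕ) (D : Finset (ℕ × ℕ)) (p : ℕ × ℕ → ℝ) (β : ℝ → ℝ) (t : ℝ)
    (d : ℕ × ℕ) : ℝ :=
  p d ^ t * (m : ℝ) ^ β t * qrow D p d.1 ^ ((1 - sig m n) * t) * gam D p t d.1 ^ (sig m n - 1)

/-- `Q_i = Σ_{j : (i,j) ∈ D} P_{ij}`. -/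
def Qrow (m n : ℕ) (D : Finset (ℕ × ℕ)) (p : ℕ × ℕ → ℝ) (β : ℝ → ℝ) (t : ℝ) (i : ℕ) : ℝ :=
  ∑ d ∈ D.filter fun d => d.1 = i, Pweight m n D p β t d

/-- `α(t) = (−σ Σ P_{ij} log p_{ij} − (1−σ) Σ Q_i log q_i)/log m`. -/
def alphaT (m n : ℕ) (D : Finset (ℕ × ℕ)) (p : ℕ × ℕ → ℝ) (β : ℝ → ℝ) (t : ℝ) : ℝ :=
  (-(sig m n) * ∑ d ∈ D, Pweight m n D p β t d * Real.log (p d) -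
      (1 - sig m n) * ∑ i ∈ Finset.range m, Qrow m n D p β t i * Real.log (qrow D p i)) /
    Real.log m

/-- `ν` is the Bernoulli (i.i.d. product) measure on `Σ = D^ℕ` with weights `P`. -/
def IsBernoulli {D : Finset (ℕ × ℕ)} (P : ℕ × ℕ → ℝ) (ν : Measure (Word D)) : Prop :=
  ∀ (k : ℕ) (w : Word D),
    ν {i : Word D | ∀ r < k, i r = w r} = ∏ r ∈ Finset.range k, ENNReal.ofReal (P (w r).1)

/-- `Z_k(𝐢)` (with the convention `inf ∅ = ∞`). -/
def Zk (m n : ℕ) {D : Finset (ℕ × ℕ)} (i : Word D) (k : ℕ) : ℝ≥0∞ :=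
  max (⨅ η ∈ {η : ℕ | 1 ≤ η ∧ (i (k + η - 1)).1.1 ≠ (i k).1.1}, (η : ℝ≥0∞))
    (ENNReal.ofReal (sig m n)⁻¹ *
      ⨅ η ∈ {η : ℕ | 1 ≤ η ∧ (i (lk m n k + η - 1)).1.2 ≠ (i (lk m n k)).1.2}, (η : ℝ≥0∞))

/-- `V_k(𝐢) = inf{l > k : row(i_l) ∉ {0, m−1} or row(i_l) ≠ row(i_{k+1})} − k − 1`. -/
def Vk (m : ℕ) {D : Finset (ℕ × ℕ)} (i : Word D) (k : ℕ) : ℝ≥0∞ :=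
  (⨅ l ∈ {l : ℕ | k < l ∧
      ((i (l - 1)).1.1 ∉ ({0, m - 1} : Set ℕ) ∨ (i (l - 1)).1.1 ≠ (i k).1.1)}, (l : ℝ≥0∞)) -
    ((k : ℝ≥0∞) + 1)

/-- `ω(i,j) = q_i^t γ_i^{−1}`. -/
def omg (D : Finset (ℕ × ℕ)) (p : ℕ × ℕ → ℝ) (t : ℝ) (d : ℕ × ℕ) : ℝ :=
  qrow D p d.1 ^ t * (gam D p t d.1)⁻¹

/-- `B_l(𝐢) = (1/l) Σ_{r=1}^l log ω(i_r)`. -/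
def Bl {D : Finset (ℕ × ℕ)} (p : ℕ × ℕ → ℝ) (t : ℝ) (i : Word D) (l : ℕ) : ℝ :=
  (1 / (l : ℝ)) * ∑ r ∈ Finset.range l, Real.log (omg D p t (i r).1)

/-- `A_k(𝐢) = B_{l(k)}(𝐢) − B_k(𝐢)`. -/
def Ak (m n : ℕ) {D : Finset (ℕ × ℕ)} (p : ℕ × ℕ → ℝ) (t : ℝ) (i : Word D) (k : ℕ) : ℝ :=
  Bl p t i (lk m n k) - Bl p t i k

/-- `R_k(𝐢) ∈ G(α, ε, k) = Y(α,ε,k) ∩ {A_k ≥ −log(1+ε)}`. -/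
def MemG (m n : ℕ) {D : Finset (ℕ × ℕ)} (μ : Measure (ℝ × ℝ)) (p : ℕ × ℕ → ℝ)
    (t α ε : ℝ) (k : ℕ) (i : Word D) : Prop :=
  MemY m n μ α ε k i ∧ -Real.log (1 + ε) ≤ Ak m n p t i k

open Classical in
/-- `Γ_k(𝐢)`: words of length `k` agreeing with `𝐢` on the first `l(k)` digits and with the
rows of `𝐢` on the remaining digits. -/
def GammaSet (m n : ℕ) {D : Finset (ℕ × ℕ)} (k : ℕ) (i : Word D) :
    Finset (Fin k → Digit D) :=
  Finset.univ.filter fun w =>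
    (∀ r : Fin k, (r : ℕ) < lk m n k → w r = i r) ∧
      ∀ r : Fin k, lk m n k ≤ (r : ℕ) → (w r).1.1 = (i (r : ℕ)).1.1

/-- `R̂_k(𝐢)`: the rectangle with the same center as `R_k(𝐢)` whose sides are `2D₁` times
longer. -/
def hatRect (m n : ℕ) {D : Finset (ℕ × ℕ)} (k : ℕ) (i : Word D) : Set (ℝ × ℝ) :=
  Icc (∑ r ∈ Finset.range (lk m n k), ((i r).1.2 : ℝ) * (n : ℝ) ^ (-(r + 1 : ℤ)) +
        (n : ℝ) ^ (-(lk m n k : ℤ)) / 2 - D1 n * (n : ℝ) ^ (-(lk m n k : ℤ)))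
      (∑ r ∈ Finset.range (lk m n k), ((i r).1.2 : ℝ) * (n : ℝ) ^ (-(r + 1 : ℤ)) +
        (n : ℝ) ^ (-(lk m n k : ℤ)) / 2 + D1 n * (n : ℝ) ^ (-(lk m n k : ℤ))) ×ˢ
  Icc (∑ r ∈ Finset.range k, ((i r).1.1 : ℝ) * (m : ℝ) ^ (-(r + 1 : ℤ)) +
        (m : ℝ) ^ (-(k : ℤ)) / 2 - D1 n * (m : ℝ) ^ (-(k : ℤ)))
      (∑ r ∈ Finset.range k, ((i r).1.1 : ℝ) * (m : ℝ) ^ (-(r + 1 : ℤ)) +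
        (m : ℝ) ^ (-(k : ℤ)) / 2 + D1 n * (m : ℝ) ^ (-(k : ℤ)))

/-- Integer whose base-`b` digits are the first `k` terms of `a`. -/
def NN (b : ℕ) (a : ℕ → ℕ) : ℕ → ℤ
  | 0 => 0
  | k + 1 => b * NN b a k + a k

lemma NN_sum (b : ℕ) (hb : 0 < b) (a : ℕ → ℕ) (k : ℕ) :
    ∑ r ∈ Finset.range k, (a r : ℝ) * (b : ℝ) ^ (-(r + 1 : ℤ)) =
      (NN b a k : ℝ) * (b : ℝ) ^ (-(k : ℤ)) := by
  have hb' : (b : ℝ) ≠ 0 := by positivity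
  induction k with
  | zero => simp [NN]
  | succ k ih =>
    rw [Finset.sum_range_succ, ih, NN]
    have : (b : ℝ) ^ (-(k : ℤ)) = b * (b : ℝ) ^ (-(k + 1 : ℤ)) := by
      rw [show (-(k : ℤ)) = 1 + (-(k + 1 : ℤ)) by ring, zpow_add₀ hb', zpow_one]
    push_cast
    rw [this]; ring

lemma NN_step {m : ℕ} {a w : ℕ → ℕ} (ha : ∀ r, a r < m) (hw : ∀ r, w r < m) {k : ℕ}
    (h : |NN m w (k + 1) - NN m a (k + 1)| ≤ 1) : |NN m w k - NN m a k| ≤ 1 := by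
  simp only [NN] at h
  have h1 := ha k
  have h2 := hw k
  rw [abs_le] at h ⊢
  constructor
  · by_contra hc
    have : NN m w k - NN m a k ≤ -2 := by omega
    nlinarith
  · by_contra hc
    have : 2 ≤ NN m w k - NN m a k := by omega
    nlinarith

lemma NN_eq {m : ℕ} {a w : ℕ → ℕ} (ha : ∀ r, a r < m) (hw : ∀ r, w r < m) {k : ℕ}
    (h : NN m w k = NN m a k) : ∀ r < k, w r = a r := by
  induction k with
  | zero => intro r hr; omega
  | succ k ih =>
    have h1 := ha k
    have h2 := hw k
    simp only [NN] at h
    have h3 : NN m w k = NN m a k := by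
      rcases lt_trichotomy (NN m w k) (NN m a k) with h' | h' | h'
      · have : NN m w k + 1 ≤ NN m a k := h'
        nlinarith
      · exact h'
      · have : NN m a k + 1 ≤ NN m w k := h'
        nlinarith
    intro r hr
    rcases Nat.lt_succ_iff_lt_or_eq.mp hr with hr | hr
    · exact ih h3 r hr
    · subst hr
      rw [h3] at h
      omega

lemma NN_change {m : ℕ} {a w : ℕ → ℕ} (ha : ∀ r, a r < m) (hw : ∀ r, w r < m) {k : ℕ}
    (h : |NN m w (k + 2) - NN m a (k + 2)| ≤ 1) (hk : a (k + 1) ≠ a k) :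
    ∀ r < k, w r = a r := by
  have h1 := NN_step ha hw h
  have h0 := NN_step ha hw h1
  apply NN_eq ha hw
  have e1 : NN m w (k+1) = m * NN m w k + w k := rfl
  have e2 : NN m a (k+1) = m * NN m a k + a k := rfl
  have e3 : NN m w (k+2) = m * NN m w (k+1) + w (k+1) := rfl
  have e4 : NN m a (k+2) = m * NN m a (k+1) + a (k+1) := rfl
  have := ha k
  have := ha (k+1)
  have := hw k
  have := hw (k+1)
  obtain ⟨d0, hd0⟩ : ∃ d, d = NN m w k - NN m a k := ⟨_, rfl⟩
  obtain ⟨d1, hd1⟩ : ∃ d, d = NN m w (k+1) - NN m a (k+1) := ⟨_, rfl⟩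
  have f1 : d1 = m * d0 + w k - a k := by rw [hd1, hd0, e1, e2]; ring
  have f2 : NN m w (k + 2) - NN m a (k + 2) = m * d1 + w (k+1) - a (k+1) := by
    rw [hd1, e3, e4]; ring
  rw [f2] at h
  rw [← hd1] at h1
  rw [← hd0] at h0
  rw [abs_le] at h h1 h0
  have c0 : d0 = -1 ∨ d0 = 0 ∨ d0 = 1 := by omega
  have c1 : d1 = -1 ∨ d1 = 0 ∨ d1 = 1 := by omega
  rcases c0 with c0 | c0 | c0
  · subst c0
    rcases c1 with c1 | c1 | c1 <;> rw [c1] at f1 h <;> omega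
  · omega
  · subst c0
    rcases c1 with c1 | c1 | c1 <;> rw [c1] at f1 h <;> omega

lemma NN_neg {m : ℕ} {a w : ℕ → ℕ} (hw : ∀ r, w r < m) {s k : ℕ}
    (h : NN m w k - NN m a k = -1) (hc : ∀ r, s ≤ r → r < k → a r = 0) :
    ∀ r, s ≤ r → r < k → w r = m - 1 := by
  induction k with
  | zero => intro r _ hr; omega
  | succ k ih =>
    intro r hr hrk
    have h0 := hc k (by omega) (by omega)
    have hk := hw k
    have e : NN m w (k+1) - NN m a (k+1) = m * (NN m w k - NN m a k) + w k := by
      simp only [NN, h0]; push_cast; ring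
    rw [h] at e
    have hd : NN m w k - NN m a k = -1 := by
      have h1 : NN m w k - NN m a k < 0 := by
        by_contra hcon
        push Not at hcon
        have : 0 ≤ (m:ℤ) * (NN m w k - NN m a k) := by positivity
        omega
      by_contra hcon
      have : NN m w k - NN m a k ≤ -2 := by omega
      nlinarith
    rcases Nat.lt_succ_iff_lt_or_eq.mp hrk with hr' | hr'
    · exact ih hd (fun r h1 h2 => hc r h1 (by omega)) r hr hr'
    · subst hr'
      rw [hd] at e
      omega

lemma NN_pos {m : ℕ} {a w : ℕ → ℕ} (hm : 0 < m) {s k : ℕ} (hw : ∀ r, w r < m)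
    (h : NN m w k - NN m a k = 1) (hc : ∀ r, s ≤ r → r < k → a r = m - 1) :
    ∀ r, s ≤ r → r < k → w r = 0 := by
  induction k with
  | zero => intro r _ hr; omega
  | succ k ih =>
    intro r hr hrk
    have h0 := hc k (by omega) (by omega)
    have hk := hw k
    have e : NN m w (k+1) - NN m a (k+1) = m * (NN m w k - NN m a k) + w k - (m - 1) := by
      simp only [NN, h0]; push_cast [Nat.cast_sub hm]; ring
    rw [h] at e
    have hd : NN m w k - NN m a k = 1 := by
      have h1 : 0 < NN m w k - NN m a k := by
        by_contra hcon
        push Not at hcon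
        have : (m:ℤ) * (NN m w k - NN m a k) ≤ 0 := by nlinarith
        omega
      by_contra hcon
      have : 2 ≤ NN m w k - NN m a k := by omega
      nlinarith
    rcases Nat.lt_succ_iff_lt_or_eq.mp hrk with hr' | hr'
    · exact ih hd (fun r h1 h2 => hc r h1 (by omega)) r hr hr'
    · subst hr'
      rw [hd] at e
      omega

lemma NN_const {m : ℕ} {a w : ℕ → ℕ} (hm : 2 ≤ m) (ha : ∀ r, a r < m) (hw : ∀ r, w r < m)
    {s k c : ℕ} (h : |NN m w (k + 1) - NN m a (k + 1)| ≤ 1)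
    (hc : ∀ r, s ≤ r → a r = c) :
    ∃ b < m, ∀ r, s ≤ r → r < k → w r = b := by
  have h1 := NN_step ha hw h
  by_cases hsk : s ≤ k
  · have e : NN m w (k+1) - NN m a (k+1) = m * (NN m w k - NN m a k) + w k - a k := by
      simp only [NN]; ring
    have := ha k
    have := hw k
    have hck := hc k hsk
    rw [abs_le] at h h1
    have c0 : NN m w k - NN m a k = -1 ∨ NN m w k - NN m a k = 0 ∨ NN m w k - NN m a k = 1 := by
      omega
    rcases c0 with c0 | c0 | c0
    · rw [c0] at e
      have hc0 : c = 0 := by omega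
      exact ⟨m - 1, by omega, NN_neg hw c0 (fun r hr _ => (hc r hr).trans hc0)⟩
    · exact ⟨c, by omega, fun r hr hrk => (NN_eq ha hw (by omega) r hrk).trans (hc r hr)⟩
    · rw [c0] at e
      have hc0 : c = m - 1 := by omega
      exact ⟨0, by omega, NN_pos (by omega) hw c0 (fun r hr _ => (hc r hr).trans hc0)⟩
  · exact ⟨0, by omega, fun r h1 h2 => by omega⟩

lemma sum_dev {f g : ℕ → ℝ} {M : ℝ} (hM : 0 ≤ M) (F : Finset ℕ) (l : ℕ)
    (h0 : ∀ r < l, r ∉ F → f r = g r) (hb : ∀ r < l, |f r - g r| ≤ M) (hl : 0 < l) :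
    |(1 / (l : ℝ)) * ∑ r ∈ Finset.range l, f r - (1 / (l : ℝ)) * ∑ r ∈ Finset.range l, g r|
      ≤ F.card * M / l := by
  have hl' : (0 : ℝ) < l := by exact_mod_cast hl
  rw [← mul_sub, ← Finset.sum_sub_distrib, abs_mul, abs_of_pos (by positivity : 0 < 1 / (l:ℝ)),
    one_div, inv_mul_eq_div]
  gcongr
  calc |∑ r ∈ Finset.range l, (f r - g r)|
      ≤ ∑ r ∈ Finset.range l, |f r - g r| := Finset.abs_sum_le_sum_abs _ _
    _ ≤ ∑ r ∈ Finset.range l, (if r ∈ F then M else 0) := by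
        apply Finset.sum_le_sum
        intro r hr
        rw [Finset.mem_range] at hr
        split_ifs with h
        · exact hb r hr
        · rw [h0 r hr h]; simp
    _ = ((Finset.range l).filter (· ∈ F)).card * M := by
        rw [← Finset.sum_filter, Finset.sum_const, nsmul_eq_mul]
    _ ≤ F.card * M := by
        gcongr
        intro r hr
        exact (Finset.mem_filter.mp hr).2

lemma sum_const_block (a : ℕ → ℕ) (G : ℕ → ℝ) (c : ℕ) {s e : ℕ} (hse : s ≤ e)
    (hc : ∀ r, s ≤ r → r < e → a r = c) :
    ∑ r ∈ Finset.range e, G (a r) = ∑ r ∈ Finset.range s, G (a r) + ((e : ℝ) - s) * G c := by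
  rw [← Finset.sum_range_add_sum_Ico _ hse]
  congr 1
  rw [Finset.sum_congr rfl (g := fun _ => G c)
    (fun r hr => by rw [hc r (Finset.mem_Ico.mp hr).1 (Finset.mem_Ico.mp hr).2])]
  simp [Nat.cast_sub hse]

lemma const_of_no_change (a : ℕ → ℕ) {s e : ℕ} (h : ∀ r, s < r → r < e → a r = a (r - 1)) :
    ∀ r, s ≤ r → r < e → a r = a s := by
  intro r hr
  induction r, hr using Nat.le_induction with
  | base => intro _; rfl
  | succ r hr ih =>
    intro hre
    rw [h (r+1) (by omega) hre]
    exact ih (by omega)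

/-- From any index beyond a change point, one reaches a change point with no larger average. -/
lemma change_le (a : ℕ → ℕ) (G : ℕ → ℝ) (hinf : ∀ K, ∃ k > K, a k ≠ a (k - 1)) (K : ℕ) :
    ∃ r0 : ℕ, ∀ r ≥ r0, ∃ k > K, a k ≠ a (k - 1) ∧
      (1 / (k : ℝ)) * ∑ j ∈ Finset.range k, G (a j) ≤
      (1 / (r : ℝ)) * ∑ j ∈ Finset.range r, G (a j) := by
  classical
  obtain ⟨k0, hk0, hk0'⟩ := hinf K
  refine ⟨k0, fun r hr => ?_⟩
  have hrpos : (0 : ℝ) < r := by exact_mod_cast (by omega : 0 < r)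
  set S : ℕ → ℝ := fun k => ∑ j ∈ Finset.range k, G (a j) with hS
  by_cases hG : r * G (a r) ≤ S r
  · -- move right
    have hex := hinf r
    let e := Nat.find hex
    have he := Nat.find_spec hex
    have hmin : ∀ q, r < q → q < e → a q = a (q - 1) := by
      intro q h1 h2
      have := Nat.find_min hex h2
      by_contra hc
      exact this ⟨h1, hc⟩
    refine ⟨e, by have : e > r := he.1; omega, he.2, ?_⟩
    have her : r < e := he.1
    have hb := sum_const_block a G (a r) her.le (const_of_no_change a hmin)
    have hepos : (0 : ℝ) < e := by exact_mod_cast (by omega : 0 < e)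
    have her' : (r : ℝ) < e := by exact_mod_cast her
    rw [one_div, one_div, inv_mul_eq_div, inv_mul_eq_div, div_le_div_iff₀ hepos hrpos]
    rw [hb]
    change (S r + (e - r) * G (a r)) * r ≤ S r * e
    nlinarith
  · push Not at hG
    let P : ℕ → Prop := fun q => a q ≠ a (q - 1)
    let s := Nat.findGreatest P r
    have hsk : k0 ≤ s := Nat.le_findGreatest hr hk0'
    have hsr : s ≤ r := Nat.findGreatest_le r
    have hPs : P s := Nat.findGreatest_spec hr hk0'
    have hmax : ∀ q, s < q → q < r + 1 → a q = a (q - 1) := by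
      intro q h1 h2
      have := Nat.findGreatest_is_greatest h1 (by omega)
      by_contra hc
      exact this hc
    have hcst := const_of_no_change a hmax
    refine ⟨s, by omega, hPs, ?_⟩
    have hb := sum_const_block a G (a s) hsr (fun q h1 h2 => hcst q h1 (by omega))
    have hspos : (0 : ℝ) < s := by exact_mod_cast (by omega : 0 < s)
    have hsr' : (s : ℝ) ≤ r := by exact_mod_cast hsr
    rw [hcst r hsr (by omega)] at hG
    rw [one_div, one_div, inv_mul_eq_div, inv_mul_eq_div, div_le_div_iff₀ hspos hrpos]
    change S r = S s + (r - s) * G (a s) at hb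
    change S s * r ≤ S r * s
    nlinarith

lemma avg_bdd {f : ℕ → ℝ} {C : ℝ} (hC : 0 ≤ C) (hf : ∀ r, |f r| ≤ C) (k : ℕ) :
    |(1 / (k : ℝ)) * ∑ j ∈ Finset.range k, f j| ≤ C := by
  rcases Nat.eq_zero_or_pos k with rfl | hk
  · simpa using hC
  · have := sum_dev (f := f) (g := fun _ => 0) hC (Finset.range k) k
      (fun r hr h => absurd (Finset.mem_range.mpr hr) h) (fun r _ => by simpa using hf r) hk
    have hk' : (k : ℝ) ≠ 0 := by positivity
    simpa [hk'] using this

lemma avg_exists {m : ℕ} (hm : 2 ≤ m) (a : ℕ → ℕ) (ha : ∀ r, a r < m) (W : ℕ → ℕ → ℕ)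
    (hW : ∀ k r, W k r < m) (K1 : ℕ) (hN : ∀ k ≥ K1, |NN m (W k) k - NN m a k| ≤ 1)
    (G : ℕ → ℝ) (l : ℕ → ℕ) (hl : ∀ k, l k ≤ k) (hlt : Tendsto l atTop atTop)
    (ε : ℝ) (hε : 0 < ε) (K : ℕ) :
    ∃ k ≥ K, -ε ≤ (1 / (l k : ℝ)) * ∑ r ∈ Finset.range (l k), G (W k r) -
      (1 / (k : ℝ)) * ∑ r ∈ Finset.range k, G (W k r) := by
  obtain ⟨C, hC, hGC⟩ : ∃ C, 0 ≤ C ∧ ∀ i < m, |G i| ≤ C :=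
    ⟨∑ i ∈ Finset.range m, |G i|, Finset.sum_nonneg (fun _ _ => abs_nonneg _), fun i hi =>
      Finset.single_le_sum (f := fun i => |G i|) (fun _ _ => abs_nonneg _)
        (Finset.mem_range.mpr hi)⟩
  have hGd : ∀ i < m, ∀ j < m, |G i - G j| ≤ 2 * C := by
    intro i hi j hj
    have h1 := abs_le.mp (hGC i hi)
    have h2 := abs_le.mp (hGC j hj)
    rw [abs_le]; constructor <;> linarith
  -- eventual smallness
  have small : ∀ (M η : ℝ), 0 < η → ∀ᶠ k : ℕ in atTop, M / k ≤ η := by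
    intro M η hη
    have := tendsto_const_div_atTop_nhds_zero_nat M
    exact (this.eventually (gt_mem_nhds hη)).mono fun _ h => h.le
  by_cases hinf : ∀ K, ∃ k > K, a k ≠ a (k - 1)
  · by_contra hcon
    push Not at hcon
    set v : ℕ → ℝ := fun k => (1 / (k : ℝ)) * ∑ j ∈ Finset.range k, G (a j) with hv
    have hvb : ∀ k, |v k| ≤ C := fun k => avg_bdd hC (fun r => hGC _ (ha r)) k
    -- at change points the average of `a` itself has grown
    have key : ∀ᶠ k in atTop, a (k + 1) ≠ a k → v (l (k + 2)) ≤ v (k + 2) - ε / 2 := by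
      have h1 := (tendsto_add_atTop_nat 2).eventually (small (4 * C) (ε / 4) (by linarith))
      have h2 := (hlt.comp (tendsto_add_atTop_nat 2)).eventually
        (small (4 * C) (ε / 4) (by linarith))
      have h3 := (hlt.comp (tendsto_add_atTop_nat 2)).eventually (eventually_ge_atTop 1)
      filter_upwards [h1, h2, h3, eventually_ge_atTop K, eventually_ge_atTop K1]
        with k h1 h2 h3 h4 h5 hk
      simp only [Function.comp] at h1 h2 h3
      have hag := NN_change ha (hW (k + 2)) (hN (k + 2) (by omega)) hk
      have hdev : ∀ q, 1 ≤ q → q ≤ k + 2 →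
          |(1 / (q : ℝ)) * ∑ r ∈ Finset.range q, G (W (k + 2) r) - v q| ≤ 4 * C / q := by
        intro q hq1 hq2
        have := sum_dev (f := fun r => G (W (k+2) r)) (g := fun r => G (a r))
          (M := 2 * C) (by positivity) {k, k + 1} q
          (fun r hr hrF => by
            simp only [Finset.mem_insert, Finset.mem_singleton, not_or] at hrF
            rw [hag r (by omega)])
          (fun r _ => hGd _ (hW _ _) _ (ha _)) (by omega)
        refine this.trans (le_of_eq ?_)
        rw [Finset.card_pair (by omega)]
        push_cast; ring
      have d1 := abs_le.mp (hdev (k + 2) (by omega) le_rfl)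
      have d2 := abs_le.mp (hdev (l (k + 2)) h3 (hl _))
      have d3 := hcon (k + 2) (by omega)
      push_cast at *
      linarith [d1.1, d1.2, d2.1, d2.2]
    -- lim inf
    set lam := liminf v atTop with hlam
    have hbd1 : IsBoundedUnder (· ≥ ·) atTop v :=
      ⟨-C, eventually_map.mpr (Eventually.of_forall fun k => (abs_le.mp (hvb k)).1)⟩
    have hbd2 : IsBoundedUnder (· ≤ ·) atTop v :=
      ⟨C, eventually_map.mpr (Eventually.of_forall fun k => (abs_le.mp (hvb k)).2)⟩
    have hlow : ∀ᶠ k in atTop, lam - ε / 8 < v k :=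
      eventually_lt_of_lt_liminf (by linarith) hbd1
    have hfreq : ∃ᶠ k in atTop, v k < lam + ε / 8 :=
      frequently_lt_of_liminf_lt hbd2.isCoboundedUnder_ge (by linarith)
    have hall := (key.and ((hlt.comp (tendsto_add_atTop_nat 2)).eventually hlow)).and
      ((tendsto_add_atTop_nat 2).eventually (small (2 * C) (ε / 8) (by linarith)))
    obtain ⟨K3, hK3⟩ := eventually_atTop.mp hall
    obtain ⟨r0, hr0⟩ := change_le a G hinf (K3 + 1)
    obtain ⟨r, hr, hvr⟩ := (frequently_atTop.mp hfreq) r0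
    obtain ⟨k, hkK, hk, hvk⟩ := hr0 r hr
    obtain ⟨k, rfl⟩ : ∃ j, k = j + 1 := ⟨k - 1, by omega⟩
    obtain ⟨⟨g1, g2⟩, g3⟩ := hK3 k (by omega)
    have g1 := g1 hk
    simp only [Function.comp] at g2
    have hvk' : v (k + 1) ≤ v r := hvk
    -- compare v (k+2) and v (k+1)
    have hstep : v (k + 2) ≤ v (k + 1) + 2 * C / ((k + 2 : ℕ) : ℝ) := by
      have hb1 := abs_le.mp (hvb (k + 1))
      have hb2 := abs_le.mp (hGC _ (ha (k + 1)))
      have e1 : ((k + 1 : ℕ) : ℝ) * v (k + 1) = ∑ j ∈ Finset.range (k + 1), G (a j) := by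
        simp only [hv]; field_simp
      have e2 : ((k + 2 : ℕ) : ℝ) * v (k + 2) =
          ((k + 1 : ℕ) : ℝ) * v (k + 1) + G (a (k + 1)) := by
        rw [e1, ← Finset.sum_range_succ]; simp only [hv]; field_simp
      have hp : (0 : ℝ) < ((k + 2 : ℕ) : ℝ) := by positivity
      rw [← sub_le_iff_le_add', le_div_iff₀ hp]
      push_cast at *
      nlinarith
    linarith
  · push Not at hinf
    obtain ⟨s, hs⟩ := hinf
    have hcst : ∀ r, s ≤ r → a r = a s := fun r hr =>
      const_of_no_change a (s := s) (e := r + 1) (fun q h1 _ => hs q h1) r hr (by omega)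
    have hev := ((small ((s + 1 : ℕ) * (2 * C)) (ε / 2) (by linarith)).and
      (hlt.eventually (small ((s + 1 : ℕ) * (2 * C)) (ε / 2) (by linarith)))).and
      (hlt.eventually (eventually_ge_atTop 1))
    obtain ⟨k, ⟨⟨h1, h2⟩, h3⟩, hkK⟩ := (hev.and (eventually_ge_atTop (max K K1))).exists
    have hkK' : K ≤ k ∧ K1 ≤ k := by simpa using hkK
    refine ⟨k, hkK'.1, ?_⟩
    have hk1 : 1 ≤ k := h3.trans (hl k)
    obtain ⟨j, rfl⟩ : ∃ j, k = j + 1 := ⟨k - 1, by omega⟩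
    obtain ⟨b, hb, hwb⟩ := NN_const hm ha (hW (j + 1)) (hN _ hkK'.2) hcst
    have hdev : ∀ q, 1 ≤ q → q ≤ j + 1 →
        |(1 / (q : ℝ)) * ∑ r ∈ Finset.range q, G (W (j + 1) r) - G b| ≤
          (s + 1 : ℕ) * (2 * C) / q := by
      intro q hq1 hq2
      have := sum_dev (f := fun r => G (W (j+1) r)) (g := fun r => G b)
        (M := 2 * C) (by positivity) (insert j (Finset.range s)) q
        (fun r hr hrF => by
          simp only [Finset.mem_insert, Finset.mem_range, not_or] at hrF
          rw [hwb r (by omega) (by omega)])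
        (fun r _ => hGd _ (hW _ _) _ hb) (by omega)
      have e : (1 / (q : ℝ)) * ∑ r ∈ Finset.range q, G b = G b := by
        have : (q : ℝ) ≠ 0 := by positivity
        simp [this]
      rw [e] at this
      refine this.trans ?_
      gcongr
      refine (Finset.card_insert_le _ _).trans ?_
      simp
    have d1 := abs_le.mp (hdev (j + 1) (by omega) le_rfl)
    have d2 := abs_le.mp (hdev (l (j + 1)) h3 (hl _))
    linarith [d1.1, d1.2, d2.1, d2.2]

lemma sig_pos {m n : ℕ} (hm : 2 ≤ m) (hmn : m < n) : 0 < sig m n := by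
  have h1 : 0 < Real.log m := Real.log_pos (by exact_mod_cast (by omega : 1 < m))
  have h2 : 0 < Real.log n := Real.log_pos (by exact_mod_cast (by omega : 1 < n))
  exact div_pos h1 h2

lemma sig_lt_one {m n : ℕ} (hm : 2 ≤ m) (hmn : m < n) : sig m n < 1 := by
  have h2 : 0 < Real.log n := Real.log_pos (by exact_mod_cast (by omega : 1 < n))
  rw [sig, div_lt_one h2]
  exact Real.log_lt_log (by positivity) (by exact_mod_cast hmn)

lemma lk_le {m n : ℕ} (hm : 2 ≤ m) (hmn : m < n) (k : ℕ) : lk m n k ≤ k := by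
  apply Nat.floor_le_of_le
  have := sig_lt_one hm hmn
  have hk : (0 : ℝ) ≤ k := by positivity
  nlinarith

lemma lk_tendsto {m n : ℕ} (hm : 2 ≤ m) (hmn : m < n) : Tendsto (lk m n) atTop atTop := by
  apply tendsto_nat_floor_atTop.comp
  exact tendsto_natCast_atTop_atTop.const_mul_atTop (sig_pos hm hmn)

lemma sig_mul_log {m n : ℕ} (hm : 2 ≤ m) (hmn : m < n) :
    sig m n * Real.log n = Real.log m := by
  have h2 : 0 < Real.log n := Real.log_pos (by exact_mod_cast (by omega : 1 < n))
  rw [sig]; field_simp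

lemma pow_lk_le {m n : ℕ} (hm : 2 ≤ m) (hmn : m < n) (k : ℕ) :
    (m : ℝ) ^ (-(k : ℤ)) ≤ (n : ℝ) ^ (-(lk m n k : ℤ)) := by
  have hm0 : (0 : ℝ) < m := by exact_mod_cast (by omega : 0 < m)
  have hn0 : (0 : ℝ) < n := by exact_mod_cast (by omega : 0 < n)
  rw [zpow_neg, zpow_neg, zpow_natCast, zpow_natCast]
  apply inv_anti₀ (by positivity)
  rw [← Real.log_le_log_iff (by positivity) (by positivity), Real.log_pow, Real.log_pow,
    ← sig_mul_log hm hmn, ← mul_assoc]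
  have h2 : 0 < Real.log n := Real.log_pos (by exact_mod_cast (by omega : 1 < n))
  gcongr
  rw [mul_comm]
  exact Nat.floor_le (mul_nonneg (sig_pos hm hmn).le (by positivity))

lemma lk_pow_le {m n : ℕ} (hm : 2 ≤ m) (hmn : m < n) (k : ℕ) :
    (n : ℝ) ^ (-(lk m n k : ℤ)) ≤ n * (m : ℝ) ^ (-(k : ℤ)) := by
  have hm0 : (0 : ℝ) < m := by exact_mod_cast (by omega : 0 < m)
  have hn0 : (0 : ℝ) < n := by exact_mod_cast (by omega : 0 < n)
  rw [zpow_neg, zpow_neg, zpow_natCast, zpow_natCast]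
  have h : (m : ℝ) ^ k ≤ n ^ (lk m n k + 1) := by
    rw [← Real.log_le_log_iff (by positivity) (by positivity), Real.log_pow, Real.log_pow,
      ← sig_mul_log hm hmn, ← mul_assoc]
    have h2 : 0 < Real.log n := Real.log_pos (by exact_mod_cast (by omega : 1 < n))
    gcongr
    rw [mul_comm]
    push_cast
    exact (Nat.lt_floor_add_one _).le
  rw [← div_eq_mul_inv, inv_eq_one_div, div_le_div_iff₀ (by positivity) (by positivity)]
  rw [pow_succ] at h
  linarith

lemma attractor_box {m n : ℕ} (hm : 2 ≤ m) (hmn : m < n)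
    {D : Finset (ℕ × ℕ)} (hD : ∀ d ∈ D, d.1 < m ∧ d.2 < n)
    {Λ : Set (ℝ × ℝ)} (hΛ : IsAttractor m n D Λ) :
    ∀ x ∈ Λ, (0 ≤ x.1 ∧ x.1 ≤ 1) ∧ (0 ≤ x.2 ∧ x.2 ≤ 1) := by
  obtain ⟨hc, hne, heq⟩ := hΛ
  have hm0 : (2 : ℝ) ≤ m := by exact_mod_cast hm
  have hn0 : (2 : ℝ) ≤ n := by exact_mod_cast (by omega : 2 ≤ n)
  have dec : ∀ x ∈ Λ, ∃ d ∈ D, ∃ y ∈ Λ, Tmap m n d y = x := by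
    intro x hx
    rw [heq] at hx
    simpa using hx
  have hcast : ∀ d ∈ D, (d.1 : ℝ) + 1 ≤ m ∧ (d.2 : ℝ) + 1 ≤ n := fun d hd =>
    ⟨by exact_mod_cast (hD d hd).1, by exact_mod_cast (hD d hd).2⟩
  obtain ⟨u1, hu1, hU1⟩ := hc.exists_isMaxOn hne continuous_fst.continuousOn
  obtain ⟨u2, hu2, hU2⟩ := hc.exists_isMaxOn hne continuous_snd.continuousOn
  obtain ⟨v1, hv1, hV1⟩ := hc.exists_isMinOn hne continuous_fst.continuousOn
  obtain ⟨v2, hv2, hV2⟩ := hc.exists_isMinOn hne continuous_snd.continuousOn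
  have a1 : u1.1 ≤ 1 := by
    obtain ⟨d, hd, y, hy, he⟩ := dec u1 hu1
    have h1 : y.1 ≤ u1.1 := hU1 hy
    have h2 : (y.1 + d.2) / n = u1.1 := congrArg Prod.fst he
    rw [div_eq_iff (by positivity)] at h2
    have := (hcast d hd).2
    nlinarith
  have a2 : u2.2 ≤ 1 := by
    obtain ⟨d, hd, y, hy, he⟩ := dec u2 hu2
    have h1 : y.2 ≤ u2.2 := hU2 hy
    have h2 : (y.2 + d.1) / m = u2.2 := congrArg Prod.snd he
    rw [div_eq_iff (by positivity)] at h2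
    have := (hcast d hd).1
    nlinarith
  have a3 : 0 ≤ v1.1 := by
    obtain ⟨d, hd, y, hy, he⟩ := dec v1 hv1
    have h1 : v1.1 ≤ y.1 := hV1 hy
    have h2 : (y.1 + d.2) / n = v1.1 := congrArg Prod.fst he
    rw [div_eq_iff (by positivity)] at h2
    have : (0 : ℝ) ≤ d.2 := by positivity
    nlinarith
  have a4 : 0 ≤ v2.2 := by
    obtain ⟨d, hd, y, hy, he⟩ := dec v2 hv2
    have h1 : v2.2 ≤ y.2 := hV2 hy
    have h2 : (y.2 + d.1) / m = v2.2 := congrArg Prod.snd he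
    rw [div_eq_iff (by positivity)] at h2
    have : (0 : ℝ) ≤ d.1 := by positivity
    nlinarith
  intro x hx
  exact ⟨⟨a3.trans (hV1 hx), le_trans (hU1 hx) a1⟩, ⟨a4.trans (hV2 hx), le_trans (hU2 hx) a2⟩⟩

/-- Every point of the attractor has a coding. -/
lemma coding {m n : ℕ} (hm : 2 ≤ m) (hmn : m < n)
    {D : Finset (ℕ × ℕ)} (hD : ∀ d ∈ D, d.1 < m ∧ d.2 < n)
    {Λ : Set (ℝ × ℝ)} (hΛ : IsAttractor m n D Λ) (x : ℝ × ℝ) (hx : x ∈ Λ) :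
    ∃ i : Word D, ∀ k,
      (NN n (fun r => (i r).1.2) k * (n : ℝ) ^ (-(k : ℤ)) ≤ x.1 ∧
       x.1 ≤ (NN n (fun r => (i r).1.2) k + 1) * (n : ℝ) ^ (-(k : ℤ))) ∧
      (NN m (fun r => (i r).1.1) k * (m : ℝ) ^ (-(k : ℤ)) ≤ x.2 ∧
       x.2 ≤ (NN m (fun r => (i r).1.1) k + 1) * (m : ℝ) ^ (-(k : ℤ))) := by
  have hbox := attractor_box hm hmn hD hΛ
  have dec : ∀ x : Λ, ∃ d : Digit D, ∃ y : Λ, Tmap m n d.1 y.1 = x.1 := by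
    rintro ⟨x, hx⟩
    have hx' := hx
    rw [hΛ.2.2] at hx'
    simp only [mem_iUnion, mem_image] at hx'
    obtain ⟨d, hd, y, hy, he⟩ := hx'
    exact ⟨⟨d, hd⟩, ⟨y, hy⟩, he⟩
  choose dg nx hnx using dec
  let X : ℕ → Λ := fun k => nx^[k] ⟨x, hx⟩
  have hX : ∀ k, Tmap m n (dg (X k)).1 (X (k + 1)).1 = (X k).1 := by
    intro k
    simp only [X, Function.iterate_succ_apply']
    exact hnx _
  have hm0 : (0 : ℝ) < m := by exact_mod_cast (by omega : 0 < m)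
  have hn0 : (0 : ℝ) < n := by exact_mod_cast (by omega : 0 < n)
  refine ⟨fun k => dg (X k), fun k => ?_⟩
  have e1 : ∀ k : ℕ, x.1 = (NN n (fun r => (dg (X r)).1.2) k + (X k).1.1) * (n : ℝ) ^ (-(k : ℤ)) := by
    intro k
    induction k with
    | zero => simp [NN, X]
    | succ k ih =>
      have h : ((X (k+1)).1.1 + (dg (X k)).1.2) / n = (X k).1.1 := congrArg Prod.fst (hX k)
      rw [ih, ← h, NN]
      have : (n : ℝ) ^ (-(k : ℤ)) = n * (n : ℝ) ^ (-((k + 1 : ℕ) : ℤ)) := by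
        rw [show (-(k : ℤ)) = 1 + (-((k + 1 : ℕ) : ℤ)) by push_cast; ring, zpow_add₀ hn0.ne', zpow_one]
      rw [this]; push_cast; field_simp; ring
  have e2 : ∀ k : ℕ, x.2 = (NN m (fun r => (dg (X r)).1.1) k + (X k).1.2) * (m : ℝ) ^ (-(k : ℤ)) := by
    intro k
    induction k with
    | zero => simp [NN, X]
    | succ k ih =>
      have h : ((X (k+1)).1.2 + (dg (X k)).1.1) / m = (X k).1.2 := congrArg Prod.snd (hX k)
      rw [ih, ← h, NN]
      have : (m : ℝ) ^ (-(k : ℤ)) = m * (m : ℝ) ^ (-((k + 1 : ℕ) : ℤ)) := by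
        rw [show (-(k : ℤ)) = 1 + (-((k + 1 : ℕ) : ℤ)) by push_cast; ring, zpow_add₀ hm0.ne', zpow_one]
      rw [this]; push_cast; field_simp; ring
  obtain ⟨⟨b1, b2⟩, b3, b4⟩ := hbox _ (X k).2
  have pn : 0 < (n : ℝ) ^ (-(k : ℤ)) := by positivity
  have pm : 0 < (m : ℝ) ^ (-(k : ℤ)) := by positivity
  rw [e1 k, e2 k]
  refine ⟨⟨?_, ?_⟩, ?_, ?_⟩ <;> apply mul_le_mul_of_nonneg_right _ (le_of_lt ‹_›) <;> linarith

lemma approxSq_eq {m n : ℕ} (hm : 2 ≤ m) (hmn : m < n) {D : Finset (ℕ × ℕ)} (k : ℕ)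
    (i : Word D) : approxSq m n k i =
    Icc (NN n (fun r => (i r).1.2) (lk m n k) * (n : ℝ) ^ (-(lk m n k : ℤ)))
      ((NN n (fun r => (i r).1.2) (lk m n k) + 1) * (n : ℝ) ^ (-(lk m n k : ℤ))) ×ˢ
    Icc (NN m (fun r => (i r).1.1) k * (m : ℝ) ^ (-(k : ℤ)))
      ((NN m (fun r => (i r).1.1) k + 1) * (m : ℝ) ^ (-(k : ℤ))) := by
  rw [approxSq, NN_sum n (by omega) (fun r => (i r).1.2), NN_sum m (by omega) (fun r => (i r).1.1)]
  rw [add_one_mul, add_one_mul]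

lemma Tmap_dist {m n : ℕ} (hm : 2 ≤ m) (hmn : m < n) (d : ℕ × ℕ) (x y : ℝ × ℝ) :
    dist (Tmap m n d x) (Tmap m n d y) ≤ dist x y / m := by
  have hm0 : (0 : ℝ) < m := by exact_mod_cast (by omega : 0 < m)
  have hmn' : (m : ℝ) ≤ n := by exact_mod_cast hmn.le
  have hn0 : (0 : ℝ) < n := hm0.trans_le hmn'
  rw [Prod.dist_eq, Prod.dist_eq, Real.dist_eq, Real.dist_eq, Real.dist_eq, Real.dist_eq]
  simp only [Tmap]
  rw [← sub_div, ← sub_div, add_sub_add_right_eq_sub, add_sub_add_right_eq_sub, abs_div, abs_div,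
    abs_of_pos hm0, abs_of_pos hn0]
  apply max_le
  · calc |x.1 - y.1| / n ≤ |x.1 - y.1| / m := by gcongr
      _ ≤ _ := by gcongr; exact le_max_left _ _
  · gcongr; exact le_max_right _ _

lemma Tmap_meas (m n : ℕ) (d : ℕ × ℕ) : Measurable (Tmap m n d) := by
  unfold Tmap; fun_prop

lemma sum_ofReal_p {D : Finset (ℕ × ℕ)} {p : ℕ × ℕ → ℝ} (hp : ∀ d ∈ D, 0 < p d)
    (hp1 : ∑ d ∈ D, p d = 1) : ∑ d ∈ D, ENNReal.ofReal (p d) = 1 := by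
  rw [← ENNReal.ofReal_sum_of_nonneg (fun d hd => (hp d hd).le), hp1, ENNReal.ofReal_one]

lemma mu_attractor {m n : ℕ} (hm : 2 ≤ m) (hmn : m < n)
    {D : Finset (ℕ × ℕ)}
    {p : ℕ × ℕ → ℝ} (hp : ∀ d ∈ D, 0 < p d) (hp1 : ∑ d ∈ D, p d = 1)
    {μ : Measure (ℝ × ℝ)} (hμ1 : IsProbabilityMeasure μ) (hμ : IsSelfAffine m n D p μ)
    {Λ : Set (ℝ × ℝ)} (hΛ : IsAttractor m n D Λ) : μ Λ = 1 := by
  have hm0 : (0 : ℝ) < m := by exact_mod_cast (by omega : 0 < m)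
  have step : ∀ δ : ℝ, μ (thickening (m * δ) Λ) ≤ μ (thickening δ Λ) := by
    intro δ
    rw [hμ (thickening δ Λ) isOpen_thickening.measurableSet]
    calc μ (thickening (m * δ) Λ)
        = ∑ d ∈ D, ENNReal.ofReal (p d) * μ (thickening (m * δ) Λ) := by
          rw [← Finset.sum_mul, sum_ofReal_p hp hp1, one_mul]
      _ ≤ _ := by
          apply Finset.sum_le_sum
          intro d hd
          gcongr
          intro z hz
          rw [mem_thickening_iff] at hz
          obtain ⟨y, hy, hzy⟩ := hz
          rw [mem_preimage, mem_thickening_iff]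
          refine ⟨Tmap m n d y, ?_, ?_⟩
          · rw [hΛ.2.2]
            exact mem_biUnion hd (mem_image_of_mem _ hy)
          · refine (Tmap_dist hm hmn d z y).trans_lt ?_
            rw [div_lt_iff₀ hm0]; linarith
  have stepk : ∀ (δ : ℝ) (k : ℕ), μ (thickening ((m : ℝ) ^ k * δ) Λ) ≤ μ (thickening δ Λ) := by
    intro δ k
    induction k with
    | zero => simp
    | succ k ih =>
      rw [pow_succ', mul_assoc]
      exact (step _).trans ih
  have full : ∀ δ : ℝ, 0 < δ → μ (thickening δ Λ) = 1 := by
    intro δ hδ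
    apply le_antisymm prob_le_one
    have hmono : Monotone (fun k : ℕ => thickening ((m : ℝ) ^ k * δ) Λ) := by
      intro a b hab
      apply thickening_mono
      have : (1 : ℝ) ≤ m := by exact_mod_cast (by omega : 1 ≤ m)
      gcongr
    have hun : (⋃ k : ℕ, thickening ((m : ℝ) ^ k * δ) Λ) = univ := by
      rw [eq_univ_iff_forall]
      intro z
      obtain ⟨y, hy⟩ := hΛ.2.1
      have h1 : (1 : ℝ) < m := by exact_mod_cast (by omega : 1 < m)
      obtain ⟨k, hk⟩ := pow_unbounded_of_one_lt (dist z y / δ) h1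
      rw [mem_iUnion]
      refine ⟨k, ?_⟩
      rw [mem_thickening_iff]
      exact ⟨y, hy, by rwa [div_lt_iff₀ hδ] at hk⟩
    have := tendsto_measure_iUnion_atTop (μ := μ) hmono
    rw [hun, measure_univ] at this
    exact le_of_tendsto' this (fun k => stepk δ k)
  have h := tendsto_measure_thickening_of_isClosed (μ := μ) (s := Λ)
    ⟨1, one_pos, measure_ne_top _ _⟩ hΛ.1.isClosed
  have h2 : Tendsto (fun r => μ (thickening r Λ)) (𝓝[>] 0) (𝓝 1) := by
    apply tendsto_const_nhds.congr'
    filter_upwards [self_mem_nhdsWithin] with r hr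
    exact (full r hr).symm
  exact tendsto_nhds_unique h h2

lemma mu_ball_pos {m n : ℕ} (hm : 2 ≤ m) (hmn : m < n)
    {D : Finset (ℕ × ℕ)} (hD : ∀ d ∈ D, d.1 < m ∧ d.2 < n)
    {p : ℕ × ℕ → ℝ} (hp : ∀ d ∈ D, 0 < p d) (hp1 : ∑ d ∈ D, p d = 1)
    {μ : Measure (ℝ × ℝ)} (hμ1 : IsProbabilityMeasure μ) (hμ : IsSelfAffine m n D p μ)
    {Λ : Set (ℝ × ℝ)} (hΛ : IsAttractor m n D Λ) (x : ℝ × ℝ) (hx : x ∈ Λ) (r : ℝ)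
    (hr : 0 < r) : 0 < μ (ball x r) := by
  have hm0 : (0 : ℝ) < m := by exact_mod_cast (by omega : 0 < m)
  have main : ∀ k : ℕ, ∀ x ∈ Λ, ∀ r : ℝ, 2 < (m : ℝ) ^ k * r → 0 < μ (ball x r) := by
    intro k
    induction k with
    | zero =>
      intro x hx r hr
      have hsub : Λ ⊆ ball x r := by
        intro y hy
        obtain ⟨⟨a1, a2⟩, a3, a4⟩ := attractor_box hm hmn hD hΛ x hx
        obtain ⟨⟨b1, b2⟩, b3, b4⟩ := attractor_box hm hmn hD hΛ y hy
        rw [mem_ball, Prod.dist_eq, Real.dist_eq, Real.dist_eq]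
        simp only [pow_zero, one_mul] at hr
        apply max_lt <;> rw [abs_lt] <;> constructor <;> linarith
      have := measure_mono (μ := μ) hsub
      rw [mu_attractor hm hmn hp hp1 hμ1 hμ hΛ] at this
      exact one_pos.trans_le this
    | succ k ih =>
      intro x hx r hr
      have hx' := hx
      rw [hΛ.2.2] at hx'
      simp only [mem_iUnion, mem_image] at hx'
      obtain ⟨d, hd, y, hy, he⟩ := hx'
      have h1 := ih y hy (m * r) (by rw [pow_succ] at hr; linarith)
      rw [hμ _ measurableSet_ball]
      refine lt_of_lt_of_le ?_ (Finset.single_le_sum (f := fun d => ENNReal.ofReal (p d) *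
        μ (Tmap m n d ⁻¹' ball x r)) (fun _ _ => zero_le) hd)
      refine ENNReal.mul_pos (by simpa using hp d hd) ?_
      refine (h1.trans_le (measure_mono ?_)).ne'
      intro z hz
      rw [mem_preimage, mem_ball, ← he]
      refine (Tmap_dist hm hmn d z y).trans_lt ?_
      rw [div_lt_iff₀ hm0]
      rw [mem_ball] at hz; linarith
  have h1 : (1 : ℝ) < m := by exact_mod_cast (by omega : 1 < m)
  obtain ⟨k, hk⟩ := pow_unbounded_of_one_lt (2 / r) h1
  exact main k x hx r (by rwa [div_lt_iff₀ hr] at hk)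

/-- Periodic family of horizontal strips of height `m^{-k}`. -/
def perStrip (m k : ℕ) (y : ℝ) : Set (ℝ × ℝ) :=
  {z | ∃ j : ℤ, 0 ≤ z.2 - y - j ∧ z.2 - y - j < ((m : ℝ) ^ k)⁻¹}

lemma perStrip_meas (m k : ℕ) (y : ℝ) : MeasurableSet (perStrip m k y) := by
  have : perStrip m k y = ⋃ j : ℤ, {z : ℝ × ℝ | 0 ≤ z.2 - y - j ∧ z.2 - y - j < ((m : ℝ) ^ k)⁻¹} := by
    ext z; simp [perStrip]
  rw [this]
  refine MeasurableSet.iUnion fun j => ?_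
  have hf : Measurable (fun z : ℝ × ℝ => z.2 - y - j) := by fun_prop
  exact (measurableSet_le measurable_const hf).inter (measurableSet_lt hf measurable_const)

lemma perStrip_decay {m n : ℕ} (hm : 2 ≤ m)
    {D : Finset (ℕ × ℕ)} (hD : ∀ d ∈ D, d.1 < m ∧ d.2 < n)
    {p : ℕ × ℕ → ℝ} (hp : ∀ d ∈ D, 0 < p d)
    {μ : Measure (ℝ × ℝ)} (hμ1 : IsProbabilityMeasure μ) (hμ : IsSelfAffine m n D p μ)
    {ρ : ℝ} (hρ : ∀ i, qrow D p i ≤ ρ) (k : ℕ) :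
    ∀ y, μ (perStrip m k y) ≤ ENNReal.ofReal ρ ^ k := by
  have hm0 : (0 : ℝ) < m := by exact_mod_cast (by omega : 0 < m)
  have hm1 : (1 : ℝ) ≤ m := by exact_mod_cast (by omega : 1 ≤ m)
  induction k with
  | zero => intro y; simpa using prob_le_one
  | succ k ih =>
    intro y
    let C : ℕ → Set (ℝ × ℝ) := fun i => {z | ∃ j : ℤ, 0 ≤ (z.2 + i) / m - y - j ∧
      (z.2 + i) / m - y - j < ((m : ℝ) ^ (k + 1))⁻¹}
    have hT : ∀ d : ℕ × ℕ, Tmap m n d ⁻¹' (perStrip m (k + 1) y) = C d.1 := fun d => rfl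
    have hCm : ∀ i, MeasurableSet (C i) := fun i => by
      have := Tmap_meas m n (i, 0) (perStrip_meas m (k + 1) y)
      rwa [hT] at this
    have hpk : 0 < (m : ℝ) ^ k := by positivity
    have hpk1 : 1 ≤ (m : ℝ) ^ k := one_le_pow₀ hm1
    have hkey : ∀ (z : ℝ × ℝ) (i : ℕ) (j : ℤ), 0 ≤ (z.2 + i) / m - y - j →
        (z.2 + i) / m - y - j < ((m : ℝ) ^ (k + 1))⁻¹ →
        0 ≤ z.2 - m * y - (m * j - i) ∧ z.2 - m * y - (m * j - i) < ((m : ℝ) ^ k)⁻¹ := by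
      intro z i j h1 h2
      have e : z.2 - m * y - (m * j - i) = m * ((z.2 + i) / m - y - j) := by field_simp; ring
      rw [e]
      refine ⟨by positivity, ?_⟩
      have e2 : ((m : ℝ) ^ k)⁻¹ = m * ((m : ℝ) ^ (k + 1))⁻¹ := by rw [pow_succ]; field_simp
      rw [e2]
      exact mul_lt_mul_of_pos_left h2 hm0
    have hle1 : ((m : ℝ) ^ k)⁻¹ ≤ 1 := inv_le_one_of_one_le₀ hpk1
    have hdisj : (↑(Finset.range m) : Set ℕ).PairwiseDisjoint C := by
      intro i hi i' hi' hne
      rw [Function.onFun, Set.disjoint_left]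
      rintro z ⟨j, h1, h2⟩ ⟨j', h1', h2'⟩
      obtain ⟨a1, a2⟩ := hkey z i j h1 h2
      obtain ⟨b1, b2⟩ := hkey z i' j' h1' h2'
      have hi : i < m := by simpa using hi
      have hi' : i' < m := by simpa using hi'
      have c1 : ((m * j - i : ℤ) : ℝ) < ((m * j' - i' : ℤ) : ℝ) + 1 := by push_cast; linarith
      have c2 : ((m * j' - i' : ℤ) : ℝ) < ((m * j - i : ℤ) : ℝ) + 1 := by push_cast; linarith
      have c1' : (m * j - i : ℤ) < (m * j' - i' : ℤ) + 1 := by exact_mod_cast c1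
      have c2' : (m * j' - i' : ℤ) < (m * j - i : ℤ) + 1 := by exact_mod_cast c2
      have c3 : (m : ℤ) * (j - j') = i - i' := by rw [mul_sub]; omega
      have c4 : j - j' = 0 := by
        rcases lt_trichotomy (j - j') 0 with h | h | h
        · have : j - j' ≤ -1 := by omega
          nlinarith
        · exact h
        · have : 1 ≤ j - j' := by omega
          nlinarith
      rw [c4] at c3
      omega
    have hsub : (⋃ i ∈ Finset.range m, C i) ⊆ perStrip m k (m * y) := by
      intro z hz
      simp only [mem_iUnion] at hz
      obtain ⟨i, _, j, h1, h2⟩ := hz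
      refine ⟨m * j - i, ?_⟩
      have := hkey z i j h1 h2
      push_cast
      exact this
    rw [hμ _ (perStrip_meas m (k + 1) y)]
    simp only [hT]
    calc ∑ d ∈ D, ENNReal.ofReal (p d) * μ (C d.1)
        = ∑ i ∈ Finset.range m, ∑ d ∈ D.filter (fun d => d.1 = i),
            ENNReal.ofReal (p d) * μ (C d.1) :=
          (Finset.sum_fiberwise_of_maps_to (fun d hd => Finset.mem_range.mpr (hD d hd).1) _).symm
      _ = ∑ i ∈ Finset.range m, ENNReal.ofReal (qrow D p i) * μ (C i) := by
          refine Finset.sum_congr rfl fun i _ => ?_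
          rw [qrow, ENNReal.ofReal_sum_of_nonneg
            (fun d hd => (hp d (Finset.mem_filter.mp hd).1).le), Finset.sum_mul]
          refine Finset.sum_congr rfl fun d hd => ?_
          rw [(Finset.mem_filter.mp hd).2]
      _ ≤ ∑ i ∈ Finset.range m, ENNReal.ofReal ρ * μ (C i) := by
          gcongr with i
          exact hρ i
      _ = ENNReal.ofReal ρ * μ (⋃ i ∈ Finset.range m, C i) := by
          rw [← Finset.mul_sum, measure_biUnion_finset hdisj (fun i _ => hCm i)]
      _ ≤ ENNReal.ofReal ρ * ENNReal.ofReal ρ ^ k := by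
          gcongr
          exact (measure_mono hsub).trans (ih _)
      _ = _ := (pow_succ' _ _).symm

lemma exists_rho {D : Finset (ℕ × ℕ)}
    (hrow : ∃ d ∈ D, ∃ d' ∈ D, d.1 ≠ d'.1)
    {p : ℕ × ℕ → ℝ} (hp : ∀ d ∈ D, 0 < p d) (hp1 : ∑ d ∈ D, p d = 1) :
    ∃ ρ : ℝ, 0 < ρ ∧ ρ < 1 ∧ ∀ i, qrow D p i ≤ ρ := by
  obtain ⟨d, hd, d', hd', hne⟩ := hrow
  obtain ⟨e, he, hmin⟩ := Finset.exists_min_image D p ⟨d, hd⟩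
  refine ⟨max (1 / 2) (1 - p e), by positivity, max_lt (by norm_num) (by linarith [hp e he]),
    fun i => le_max_of_le_right ?_⟩
  obtain ⟨f, hf, hfi⟩ : ∃ f ∈ D, f.1 ≠ i := by
    by_cases h : d.1 = i
    · exact ⟨d', hd', fun h' => hne (h.trans h'.symm)⟩
    · exact ⟨d, hd, h⟩
  have h1 : qrow D p i + ∑ d ∈ D.filter (fun d => ¬ d.1 = i), p d = 1 := by
    rw [qrow, Finset.sum_filter_add_sum_filter_not, hp1]
  have h2 : p f ≤ ∑ d ∈ D.filter (fun d => ¬ d.1 = i), p d :=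
    Finset.single_le_sum (f := p) (fun d hd => (hp d (Finset.mem_filter.mp hd).1).le)
      (Finset.mem_filter.mpr ⟨hf, hfi⟩)
  linarith [hmin f hf]

lemma scale_tendsto {m : ℕ} (hm : 2 ≤ m) {c : ℝ} (hc : 0 < c) :
    Tendsto (fun k : ℕ => c * (m : ℝ) ^ (-(k : ℤ))) atTop (𝓝[>] 0) := by
  have hm0 : (0 : ℝ) < m := by exact_mod_cast (by omega : 0 < m)
  rw [tendsto_nhdsWithin_iff]
  constructor
  · have h : Tendsto (fun k : ℕ => ((m : ℝ)⁻¹) ^ k) atTop (𝓝 0) :=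
      tendsto_pow_atTop_nhds_zero_of_lt_one (by positivity)
        (inv_lt_one_of_one_lt₀ (by exact_mod_cast (by omega : 1 < m)))
    have := h.const_mul c
    rw [mul_zero] at this
    refine this.congr fun k => ?_
    rw [zpow_neg, zpow_natCast, inv_pow]
  · exact Eventually.of_forall fun k => by simp only [mem_Ioi]; positivity

lemma log_scale {m : ℕ} (hm : 2 ≤ m) {c : ℝ} (hc : 0 < c) (k : ℕ) :
    Real.log (c * (m : ℝ) ^ (-(k : ℤ))) = Real.log c - k * Real.log m := by
  have hm0 : (0 : ℝ) < m := by exact_mod_cast (by omega : 0 < m)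
  rw [Real.log_mul hc.ne' (by positivity), Real.log_zpow]; push_cast; ring

lemma alpha_pos {m n : ℕ} (hm : 2 ≤ m) (hmn : m < n)
    {D : Finset (ℕ × ℕ)} (hD : ∀ d ∈ D, d.1 < m ∧ d.2 < n)
    (hrow : ∃ d ∈ D, ∃ d' ∈ D, d.1 ≠ d'.1)
    {p : ℕ × ℕ → ℝ} (hp : ∀ d ∈ D, 0 < p d) (hp1 : ∑ d ∈ D, p d = 1)
    {μ : Measure (ℝ × ℝ)} (hμ1 : IsProbabilityMeasure μ) (hμ : IsSelfAffine m n D p μ)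
    {Λ : Set (ℝ × ℝ)} (hΛ : IsAttractor m n D Λ) {x : ℝ × ℝ} (hx : x ∈ Λ) {α : ℝ}
    (hα : HasLocalDim μ x α) : 0 < α := by
  obtain ⟨ρ, hρ0, hρ1, hρ⟩ := exists_rho hrow hp hp1
  have hm0 : (0 : ℝ) < m := by exact_mod_cast (by omega : 0 < m)
  have hlm : 0 < Real.log m := Real.log_pos (by exact_mod_cast (by omega : 1 < m))
  have hl2 : 0 < Real.log 2 := Real.log_pos (by norm_num)
  have hlρ : Real.log ρ < 0 := Real.log_neg hρ0 hρ1
  have ht := hα.comp (scale_tendsto hm (c := 1 / 2) (by norm_num))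
  have hbound : ∀ᶠ k : ℕ in atTop, (-Real.log ρ) / (Real.log m + Real.log 2) ≤
      ((fun r : ℝ => Real.log (μ (ball x r)).toReal / Real.log r) ∘
        fun k : ℕ => 1 / 2 * (m : ℝ) ^ (-(k : ℤ))) k := by
    filter_upwards [eventually_ge_atTop 1] with k hk
    have hk' : (1 : ℝ) ≤ k := by exact_mod_cast hk
    simp only [Function.comp]
    set r := 1 / 2 * (m : ℝ) ^ (-(k : ℤ)) with hr
    have hr0 : 0 < r := by positivity
    have hlr : Real.log r = -(k * Real.log m + Real.log 2) := by
      rw [hr, log_scale hm (by norm_num), one_div, Real.log_inv]; ring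
    have hsub : ball x r ⊆ perStrip m k (x.2 - r) := by
      intro z hz
      rw [mem_ball, Prod.dist_eq] at hz
      have h2 : |z.2 - x.2| < r := (le_max_right _ _).trans_lt hz
      rw [abs_lt] at h2
      refine ⟨0, ?_, ?_⟩
      · push_cast; linarith
      · have : ((m : ℝ) ^ k)⁻¹ = 2 * r := by rw [hr, zpow_neg, zpow_natCast]; ring
        rw [this]; push_cast; linarith
    have h1 : (μ (ball x r)).toReal ≤ ρ ^ k := by
      have := (measure_mono hsub).trans (perStrip_decay hm hD hp hμ1 hμ hρ k (x.2 - r))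
      rw [← ENNReal.ofReal_pow hρ0.le] at this
      exact ENNReal.toReal_le_of_le_ofReal (by positivity) this
    have h0 : 0 < (μ (ball x r)).toReal :=
      ENNReal.toReal_pos (mu_ball_pos hm hmn hD hp hp1 hμ1 hμ hΛ x hx r hr0).ne'
        (measure_ne_top _ _)
    have h3 : Real.log (μ (ball x r)).toReal ≤ k * Real.log ρ := by
      rw [← Real.log_pow]; exact Real.log_le_log h0 h1
    rw [hlr, div_neg, ← neg_div, div_le_div_iff₀ (by positivity) (by positivity)]
    have : k * (-Real.log ρ) ≤ -Real.log (μ (ball x r)).toReal := by linarith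
    have e1 : -Real.log ρ * (k * Real.log m + Real.log 2) ≤
        k * (-Real.log ρ) * (Real.log m + Real.log 2) := by
      have : 0 ≤ (k - 1) * ((-Real.log ρ) * Real.log 2) :=
        mul_nonneg (by linarith) (mul_nonneg (by linarith) hl2.le)
      nlinarith
    refine e1.trans ?_
    gcongr
  have := ge_of_tendsto ht hbound
  refine lt_of_lt_of_le ?_ this
  apply div_pos <;> linarith

lemma int_near {a b : ℤ} {e x z : ℝ} (he : 0 < e) (h1 : a * e ≤ x) (h2 : x ≤ (a + 1) * e)
    (h3 : b * e ≤ z) (h4 : z ≤ (b + 1) * e) (h : |z - x| < e) : |b - a| ≤ 1 := by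
  rw [abs_lt] at h
  have c1 : (b : ℝ) < a + 2 := by
    refine lt_of_mul_lt_mul_right ?_ he.le
    linarith
  have c2 : (a : ℝ) < b + 2 := by
    refine lt_of_mul_lt_mul_right ?_ he.le
    linarith
  have c1' : b < a + 2 := by exact_mod_cast c1
  have c2' : a < b + 2 := by exact_mod_cast c2
  rw [abs_le]; constructor <;> omega

lemma near_square {m n : ℕ} (hm : 2 ≤ m) (hmn : m < n)
    {D : Finset (ℕ × ℕ)} (hD : ∀ d ∈ D, d.1 < m ∧ d.2 < n)
    {p : ℕ × ℕ → ℝ} (hp : ∀ d ∈ D, 0 < p d) (hp1 : ∑ d ∈ D, p d = 1)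
    {μ : Measure (ℝ × ℝ)} (hμ1 : IsProbabilityMeasure μ) (hμ : IsSelfAffine m n D p μ)
    {Λ : Set (ℝ × ℝ)} (hΛ : IsAttractor m n D Λ) {x : ℝ × ℝ} (hx : x ∈ Λ) (i : Word D)
    (hi : ∀ k,
      (NN n (fun r => (i r).1.2) k * (n : ℝ) ^ (-(k : ℤ)) ≤ x.1 ∧
       x.1 ≤ (NN n (fun r => (i r).1.2) k + 1) * (n : ℝ) ^ (-(k : ℤ))) ∧
      (NN m (fun r => (i r).1.1) k * (m : ℝ) ^ (-(k : ℤ)) ≤ x.2 ∧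
       x.2 ≤ (NN m (fun r => (i r).1.1) k + 1) * (m : ℝ) ^ (-(k : ℤ)))) (k : ℕ) :
    ∃ w : Word D, (∃ z ∈ ball x ((m : ℝ) ^ (-(k : ℤ))), z ∈ approxSq m n k w) ∧
      |NN m (fun r => (w r).1.1) k - NN m (fun r => (i r).1.1) k| ≤ 1 ∧
      μ.real (ball x ((m : ℝ) ^ (-(k : ℤ)))) ≤ 10 * μ.real (approxSq m n k w) := by
  have hm0 : (0 : ℝ) < m := by exact_mod_cast (by omega : 0 < m)
  have hn0 : (0 : ℝ) < n := by exact_mod_cast (by omega : 0 < n)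
  set e := (m : ℝ) ^ (-(k : ℤ)) with he
  have he0 : 0 < e := by positivity
  set l := lk m n k with hl
  have hee : e ≤ (n : ℝ) ^ (-(l : ℤ)) := pow_lk_le hm hmn k
  by_contra hcon
  push Not at hcon
  set T : Finset (ℤ × ℤ) := Finset.Icc (-1) 1 ×ˢ Finset.Icc (-1) 1 with hT
  let V : ℤ × ℤ → Set (Word D) := fun c => {w | (∃ z ∈ ball x e, z ∈ approxSq m n k w) ∧
    NN m (fun r => (w r).1.1) k - NN m (fun r => (i r).1.1) k = c.1 ∧
    NN n (fun r => (w r).1.2) l - NN n (fun r => (i r).1.2) l = c.2}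
  let U : ℤ × ℤ → Set (ℝ × ℝ) := fun c => ⋃ w ∈ V c, approxSq m n k w
  have hcov : ball x e ∩ Λ ⊆ ⋃ c ∈ T, U c := by
    rintro z ⟨hz, hzΛ⟩
    obtain ⟨w, hw⟩ := coding hm hmn hD hΛ z hzΛ
    have hz' := hz
    rw [mem_ball, Prod.dist_eq] at hz'
    have d1 : |z.1 - x.1| < e := (le_max_left _ _).trans_lt hz'
    have d2 : |z.2 - x.2| < e := (le_max_right _ _).trans_lt hz'
    have n1 := int_near (by positivity) (hi l).1.1 (hi l).1.2 (hw l).1.1 (hw l).1.2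
      (d1.trans_le hee)
    have n2 := int_near he0 (hi k).2.1 (hi k).2.2 (hw k).2.1 (hw k).2.2 d2
    have hzR : z ∈ approxSq m n k w := by
      rw [approxSq_eq hm hmn]
      exact ⟨(hw l).1, (hw k).2⟩
    refine mem_biUnion (x := (NN m (fun r => (w r).1.1) k - NN m (fun r => (i r).1.1) k,
      NN n (fun r => (w r).1.2) l - NN n (fun r => (i r).1.2) l)) ?_ ?_
    · rw [abs_le] at n1 n2
      simp only [hT, Finset.coe_product, Finset.coe_Icc, Set.mem_prod, Set.mem_Icc]
      exact ⟨n2, n1⟩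
    · exact mem_biUnion (x := w) ⟨⟨z, hz, hzR⟩, rfl, rfl⟩ hzR
  have hU : ∀ c ∈ T, μ.real (U c) ≤ μ.real (ball x e) / 10 := by
    intro c hc
    rcases (V c).eq_empty_or_nonempty with hV | ⟨w, hw⟩
    · have : U c = ∅ := by simp only [U, hV]; simp
      rw [this, measureReal_empty]; positivity
    · have hsub : U c ⊆ approxSq m n k w := by
        refine iUnion₂_subset fun w' hw' => ?_
        have e1 : NN m (fun r => (w' r).1.1) k = NN m (fun r => (w r).1.1) k := by
          have := hw.2.1; have := hw'.2.1; omega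
        have e2 : NN n (fun r => (w' r).1.2) l = NN n (fun r => (w r).1.2) l := by
          have := hw.2.2; have := hw'.2.2; omega
        rw [approxSq_eq hm hmn, approxSq_eq hm hmn, ← hl, e1, e2]
      have h1 := hcon w hw.1 (by
        rw [hw.2.1]
        simp only [hT, Finset.mem_product, Finset.mem_Icc] at hc
        exact abs_le.mpr hc.1)
      have h2 := measureReal_mono (μ := μ) hsub
      linarith
  have hball : μ.real (ball x e) = μ.real (ball x e ∩ Λ) := by
    have h0 : μ Λᶜ = 0 :=
      (prob_compl_eq_zero_iff hΛ.1.isClosed.measurableSet).mpr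
        (mu_attractor hm hmn hp hp1 hμ1 hμ hΛ)
    rw [measureReal_def, measureReal_def, measure_inter_conull h0]
  have hsum : μ.real (ball x e) ≤ 9 * (μ.real (ball x e) / 10) := by
    calc μ.real (ball x e) = μ.real (ball x e ∩ Λ) := hball
      _ ≤ μ.real (⋃ c ∈ T, U c) := measureReal_mono hcov (measure_ne_top _ _)
      _ ≤ ∑ c ∈ T, μ.real (U c) := measureReal_biUnion_finset_le _ _
      _ ≤ ∑ c ∈ T, μ.real (ball x e) / 10 := Finset.sum_le_sum hU
      _ = _ := by
        rw [Finset.sum_const, nsmul_eq_mul]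
        have : T.card = 9 := by rw [hT]; decide
        rw [this]; norm_num
  have hpos : 0 < μ.real (ball x e) :=
    ENNReal.toReal_pos (mu_ball_pos hm hmn hD hp hp1 hμ1 hμ hΛ x hx e he0).ne'
      (measure_ne_top _ _)
  linarith

lemma near_Y {m n : ℕ} (hm : 2 ≤ m) (hmn : m < n)
    {D : Finset (ℕ × ℕ)} (hD : ∀ d ∈ D, d.1 < m ∧ d.2 < n)
    (hrow : ∃ d ∈ D, ∃ d' ∈ D, d.1 ≠ d'.1)
    {p : ℕ × ℕ → ℝ} (hp : ∀ d ∈ D, 0 < p d) (hp1 : ∑ d ∈ D, p d = 1)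
    {μ : Measure (ℝ × ℝ)} (hμ1 : IsProbabilityMeasure μ) (hμ : IsSelfAffine m n D p μ)
    {Λ : Set (ℝ × ℝ)} (hΛ : IsAttractor m n D Λ) {x : ℝ × ℝ} (hx : x ∈ Λ) {α : ℝ}
    (hα : HasLocalDim μ x α) (i : Word D)
    (hi : ∀ k,
      (NN n (fun r => (i r).1.2) k * (n : ℝ) ^ (-(k : ℤ)) ≤ x.1 ∧
       x.1 ≤ (NN n (fun r => (i r).1.2) k + 1) * (n : ℝ) ^ (-(k : ℤ))) ∧
      (NN m (fun r => (i r).1.1) k * (m : ℝ) ^ (-(k : ℤ)) ≤ x.2 ∧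
       x.2 ≤ (NN m (fun r => (i r).1.1) k + 1) * (m : ℝ) ^ (-(k : ℤ)))) (ε : ℝ) (hε : 0 < ε) :
    ∀ᶠ k : ℕ in atTop, ∃ w : Word D,
      infDist x (approxSq m n k w) ≤ D1 n * (m : ℝ) ^ (-(k : ℝ)) ∧
      MemY m n μ α ε k w ∧
      |NN m (fun r => (w r).1.1) k - NN m (fun r => (i r).1.1) k| ≤ 1 := by
  have hα0 := alpha_pos hm hmn hD hrow hp hp1 hμ1 hμ hΛ hx hα
  have hm0 : (0 : ℝ) < m := by exact_mod_cast (by omega : 0 < m)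
  have hn0 : (0 : ℝ) < n := by exact_mod_cast (by omega : 0 < n)
  have hlm : 0 < Real.log m := Real.log_pos (by exact_mod_cast (by omega : 1 < m))
  have t1 := hα.comp (scale_tendsto hm (c := 1) (by norm_num))
  have t2 := hα.comp (scale_tendsto hm (c := n + 1) (by positivity))
  have ev1 := t1.eventually (gt_mem_nhds (show α < α * (1 + ε / 2) by nlinarith))
  have ev2 := t2.eventually (lt_mem_nhds (show α * (1 - ε / 2) < α by nlinarith))
  have big : ∀ c : ℝ, 0 < c → ∀ M : ℝ, ∀ᶠ k : ℕ in atTop, M < k * c := fun c hc M =>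
    (tendsto_natCast_atTop_atTop.atTop_mul_const hc).eventually (eventually_gt_atTop M)
  filter_upwards [ev1, ev2, big (Real.log m * α * (ε / 2)) (by positivity) (Real.log 10),
    big (α * (ε / 2) * Real.log m) (by positivity) (α * (1 - ε / 2) * Real.log (n + 1)),
    big (Real.log m) hlm (Real.log (n + 1)), big (Real.log m) hlm 0]
    with k h1 h2 h3 h4 h5 h6
  obtain ⟨w, ⟨z, hz, hzR⟩, hN, hμw⟩ :=
    near_square hm hmn hD hp hp1 hμ1 hμ hΛ hx i hi k
  simp only [Function.comp] at h1 h2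
  rw [log_scale hm (by norm_num)] at h1
  rw [log_scale hm (by positivity)] at h2
  rw [one_mul, Real.log_one, zero_sub] at h1
  set e := (m : ℝ) ^ (-(k : ℤ)) with he
  have he0 : 0 < e := by positivity
  have hb1 : 0 < μ.real (ball x e) :=
    ENNReal.toReal_pos (mu_ball_pos hm hmn hD hp hp1 hμ1 hμ hΛ x hx e he0).ne'
      (measure_ne_top _ _)
  have hR0 : 0 < μ.real (approxSq m n k w) := by linarith
  refine ⟨w, ?_, ⟨?_, ?_⟩, hN⟩
  · have e1 : (m : ℝ) ^ (-(k : ℝ)) = e := by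
      rw [he, ← Real.rpow_intCast]; push_cast; rfl
    rw [e1]
    have hD1 : 1 ≤ D1 n := by
      rw [D1, Real.one_le_sqrt]; nlinarith
    calc infDist x (approxSq m n k w) ≤ dist x z := infDist_le_dist_of_mem hzR
      _ ≤ e := by rw [dist_comm]; exact (mem_ball.mp hz).le
      _ ≤ D1 n * e := by nlinarith
  · rw [ENNReal.ofReal_le_iff_le_toReal (measure_ne_top _ _), Real.rpow_def_of_pos hm0]
    change _ ≤ μ.real (approxSq m n k w)
    rw [← Real.le_log_iff_exp_le hR0]
    have g1 : Real.log (μ.real (ball x e)) ≤ Real.log 10 + Real.log (μ.real (approxSq m n k w)) := by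
      rw [← Real.log_mul (by norm_num) hR0.ne']
      exact Real.log_le_log hb1 hμw
    change Real.log (μ.real (ball x e)) / _ < _ at h1
    rw [div_neg, ← neg_div, div_lt_iff₀ h6] at h1
    nlinarith
  · rw [ENNReal.le_ofReal_iff_toReal_le (measure_ne_top _ _) (by positivity),
      Real.rpow_def_of_pos hm0]
    change μ.real (approxSq m n k w) ≤ _
    rw [← Real.log_le_iff_le_exp hR0]
    have hsub : approxSq m n k w ⊆ ball x ((n + 1) * e) := by
      intro u hu
      rw [approxSq_eq hm hmn] at hu hzR
      obtain ⟨⟨u1, u2⟩, u3, u4⟩ := hu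
      obtain ⟨⟨z1, z2⟩, z3, z4⟩ := hzR
      have hle := lk_pow_le hm hmn k
      rw [← he] at hle u3 u4 z3 z4
      have h1n : (1 : ℝ) ≤ n := by exact_mod_cast (by omega : 1 ≤ n)
      have hen : e ≤ n * e := by nlinarith
      rw [mem_ball, Prod.dist_eq] at hz
      have d1 : |z.1 - x.1| < e := (le_max_left _ _).trans_lt hz
      have d2 : |z.2 - x.2| < e := (le_max_right _ _).trans_lt hz
      rw [abs_lt] at d1 d2
      rw [mem_ball, Prod.dist_eq, Real.dist_eq, Real.dist_eq]
      apply max_lt <;> rw [abs_lt] <;> constructor <;> linarith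
    have g1 : Real.log (μ.real (approxSq m n k w)) ≤ Real.log (μ.real (ball x ((n + 1) * e))) :=
      Real.log_le_log hR0 (measureReal_mono hsub)
    change _ < Real.log (μ.real (ball x ((n + 1) * e))) / _ at h2
    rw [lt_div_iff_of_neg (by linarith)] at h2
    nlinarith

theorem key_proposition
    (m n : ℕ) (hm : 2 ≤ m) (hmn : m < n)
    (D : Finset (ℕ × ℕ)) (hD : ∀ d ∈ D, d.1 < m ∧ d.2 < n)
    (hrow : ∃ d ∈ D, ∃ d' ∈ D, d.1 ≠ d'.1)
    (hcol : ∃ d ∈ D, ∃ d' ∈ D, d.2 ≠ d'.2)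
    (p : ℕ × ℕ → ℝ) (hp : ∀ d ∈ D, 0 < p d) (hp1 : ∑ d ∈ D, p d = 1)
    (μ : Measure (ℝ × ℝ)) (hμ1 : IsProbabilityMeasure μ) (hμ : IsSelfAffine m n D p μ)
    (Λ : Set (ℝ × ℝ)) (hΛ : IsAttractor m n D Λ)

    (t : ℝ) :
    ∀ ε > (0 : ℝ), ∀ (α : ℝ), ∀ x ∈ levelSet μ Λ α, ∀ K : ℕ, ∃ k ≥ K, ∃ i : Word D,
      infDist x (approxSq m n k i) ≤ D1 n * (m : ℝ) ^ (-(k : ℝ)) ∧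
        -ε ≤ Ak m n p t i k ∧ MemY m n μ α ε k i := by
  intro ε hε α x hx K
  obtain ⟨hxΛ, hα⟩ := hx
  obtain ⟨i, hi⟩ := coding hm hmn hD hΛ x hxΛ
  obtain ⟨K1, hK1⟩ := eventually_atTop.mp
    (near_Y hm hmn hD hrow hp hp1 hμ1 hμ hΛ hxΛ hα i hi ε hε)
  have hch : ∀ k, ∃ w : Word D, k ≥ K1 →
      (infDist x (approxSq m n k w) ≤ D1 n * (m : ℝ) ^ (-(k : ℝ)) ∧
      MemY m n μ α ε k w ∧
      |NN m (fun r => (w r).1.1) k - NN m (fun r => (i r).1.1) k| ≤ 1) := by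
    intro k
    by_cases h : k ≥ K1
    · obtain ⟨w, hw⟩ := hK1 k h
      exact ⟨w, fun _ => hw⟩
    · exact ⟨i, fun h' => absurd h' h⟩
  choose w hw using hch
  obtain ⟨k, hk, hA⟩ := avg_exists hm (fun r => (i r).1.1) (fun r => (hD _ (i r).2).1)
    (fun k r => (w k r).1.1) (fun k r => (hD _ (w k r).2).1) K1
    (fun k hk => (hw k hk).2.2)
    (fun a => Real.log (qrow D p a ^ t * (gam D p t a)⁻¹)) (lk m n) (lk_le hm hmn)
    (lk_tendsto hm hmn) ε hε (max K K1)
  have hk' : K ≤ k ∧ K1 ≤ k := by simpa using hk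
  exact ⟨k, hk'.1, w k, (hw k hk'.2).1, hA, (hw k hk'.2).2.1⟩

end BedfordMcMullen
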